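/- arXiv:1907.02367 — 2 statements merged into one kernel-verified Lean document; each statement's English description precedes it below -/
import Mathlib

section
/- Let n ≥ 1, p ≥ 1, c > 0. The dimension of the second-order polynomial Trefftz space is dim 𝕌^p = C(p+n, n) + C(p−1+n, n), where C(a,b) denotes the binomial coefficient a!/(b!(a−b)!). -/
open MvPolynomial

/-- The second-order acoustic wave operator `U ↦ −ΔU + c⁻² ∂ₜₜU` acting on real polynomials
in the `n` space variables (indexed by `Sum.inl`) and the time variable (`Sum.inr ()`). -/
noncomputable def waveOp (n : ℕ) (c : ℝ) :
    MvPolynomial (Fin n ⊕ Unit) ℝ →ₗ[ℝ] MvPolynomial (Fin n ⊕ Unit) ℝ :=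
  (c ^ 2)⁻¹ • ((pderiv (Sum.inr ())).toLinearMap ∘ₗ (pderiv (Sum.inr ())).toLinearMap)
    - ∑ m : Fin n, ((pderiv (Sum.inl m)).toLinearMap ∘ₗ (pderiv (Sum.inl m)).toLinearMap)

/-- The second-order polynomial Trefftz space
`𝕌^p = {U ∈ ℙ^p(ℝ^{n+1}) : −ΔU + c⁻²∂ₜₜU = 0}`. -/
noncomputable def trefftzU (n p : ℕ) (c : ℝ) :
    Submodule ℝ (MvPolynomial (Fin n ⊕ Unit) ℝ) :=
  restrictTotalDegree (Fin n ⊕ Unit) ℝ p ⊓ LinearMap.ker (waveOp n c)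

/-- Evaluation at time `t = 0`: the algebra map sending a space-time polynomial `U` to the
polynomial `U(·, 0)` in the space variables only. -/
noncomputable def evalTimeZero (n : ℕ) :
    MvPolynomial (Fin n ⊕ Unit) ℝ →ₐ[ℝ] MvPolynomial (Fin n) ℝ :=
  aeval (Sum.elim X fun _ => 0)

/-- The number of exponent vectors of degree `d` is `Nat.multichoose`. -/
theorem Finsupp.ncard_degree_eq (σ : Type*) [Fintype σ] (d : ℕ) :
    {s : σ →₀ ℕ | s.degree = d}.ncard = (Fintype.card σ).multichoose d := by
  classical
  rw [← Finset.card_univ, ← Finset.card_finsuppAntidiag_nat_eq_multichoose d,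
    ← Set.ncard_coe_finset]
  congr 1
  ext s
  simp [Finset.mem_finsuppAntidiag, Finsupp.degree_eq_sum]

theorem Finsupp.ncard_degree_le (σ : Type*) [Fintype σ] {p : ℕ} (hp : 1 ≤ p) :
    {s : σ →₀ ℕ | s.degree ≤ p}.ncard = {s : σ →₀ ℕ | s.degree + 2 ≤ p}.ncard +
      ((Fintype.card σ).multichoose p + (Fintype.card σ).multichoose (p - 1)) := by
  have hfin (d : ℕ) : {s : σ →₀ ℕ | s.degree = d}.Finite := Finsupp.finite_of_degree_eq d
  have hfin' : {s : σ →₀ ℕ | s.degree + 2 ≤ p}.Finite :=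
    (Finsupp.finite_of_degree_le p).subset fun s hs => by
      simp only [Set.mem_ofPred_eq] at hs ⊢
      omega
  rw [← Finsupp.ncard_degree_eq, ← Finsupp.ncard_degree_eq,
    ← Set.ncard_union_eq _ (hfin _) (hfin _),
    ← Set.ncard_union_eq _ hfin' ((hfin _).union (hfin _))]
  · congr 1
    ext s
    simp only [Set.mem_ofPred_eq, Set.mem_union]
    omega
  all_goals
    rw [Set.disjoint_left]
    intro s hs hs'
    simp only [Set.mem_ofPred_eq, Set.mem_union] at hs hs'
    omega

namespace MvPolynomial

theorem finrank_restrictSupport {R σ : Type*} [CommRing R] [Nontrivial R] (S : Set (σ →₀ ℕ)) :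
    Module.finrank R (restrictSupport R S) = S.ncard :=
  Module.finrank_eq_nat_card_basis (basisRestrictSupport R S)

theorem restrictTotalDegree_eq_restrictSupport_degree (R σ : Type*) [CommSemiring R] (p : ℕ) :
    restrictTotalDegree σ R p = restrictSupport R {s | s.degree ≤ p} :=
  rfl

theorem pderiv_pderiv_monomial {R σ : Type*} [CommRing R] (i : σ) (s : σ →₀ ℕ) (a : R) :
    pderiv i (pderiv i (monomial s a)) =
      monomial (s - Finsupp.single i 2) (a * (s i * (s i - 1))) := by
  classical
  rw [pderiv_monomial, pderiv_monomial, tsub_tsub, ← Finsupp.single_add, mul_assoc]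
  rcases Nat.eq_zero_or_pos (s i) with h | h
  · simp [h]
  · simp [Nat.cast_sub (Nat.one_le_iff_ne_zero.2 h.ne')]

theorem pderiv_pderiv_mem_restrictSupport {R σ : Type*} [CommRing R] {p : ℕ} (i : σ)
    {f : MvPolynomial σ R} (hf : f ∈ restrictSupport R {s | s.degree ≤ p}) :
    pderiv i (pderiv i f) ∈ restrictSupport R {s | s.degree + 2 ≤ p} := by
  rw [mem_restrictSupport_iff] at hf ⊢
  intro s hs
  rw [Finset.mem_coe, mem_support_iff, coeff_pderiv, coeff_pderiv] at hs
  have := hf (mem_support_iff.2 (left_ne_zero_of_mul (left_ne_zero_of_mul hs)))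
  simp only [Set.mem_ofPred_eq, map_add, Finsupp.degree_single] at this ⊢
  omega

end MvPolynomial

theorem waveOp_apply (n : ℕ) (c : ℝ) (f : MvPolynomial (Fin n ⊕ Unit) ℝ) :
    waveOp n c f = (c ^ 2)⁻¹ • pderiv (Sum.inr ()) (pderiv (Sum.inr ()) f) -
      ∑ m : Fin n, pderiv (Sum.inl m) (pderiv (Sum.inl m) f) := by
  simp [waveOp]

/-- Every monomial of degree at most `p - 2` is the image under the wave operator of a polynomial
of degree at most `p`: integrate twice in time, and induct on the degree in space. -/
theorem monomial_mem_map_waveOp {n p : ℕ} {c : ℝ} (hc : c ≠ 0) (s : (Fin n ⊕ Unit) →₀ ℕ)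
    (hs : s.degree + 2 ≤ p) (a : ℝ) :
    monomial s a ∈ (restrictSupport ℝ {s | s.degree ≤ p}).map (waveOp n c) := by
  induction hd : ∑ m : Fin n, s (Sum.inl m) using Nat.strong_induction_on generalizing s a with
  | _ d ih =>
  set k := s (Sum.inr ()) with hk
  set b : ℝ := a * c ^ 2 / ((k + 2) * (k + 1)) with hb
  set e : (Fin n ⊕ Unit) →₀ ℕ := s + Finsupp.single (Sum.inr ()) 2 with he
  have hmem : monomial e b ∈ restrictSupport ℝ {s | s.degree ≤ p} := by
    simp [he, hs]
  have htime : (c ^ 2)⁻¹ • pderiv (Sum.inr ()) (pderiv (Sum.inr ()) (monomial e b)) =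
      monomial s a := by
    rw [pderiv_pderiv_monomial, he, add_tsub_cancel_right, smul_monomial]
    congr 1
    simp only [Finsupp.add_apply, Finsupp.single_eq_same, ← hk, hb, smul_eq_mul]
    push_cast
    field_simp
    ring
  have key : monomial s a = waveOp n c (monomial e b) +
      ∑ m : Fin n, pderiv (Sum.inl m) (pderiv (Sum.inl m) (monomial e b)) := by
    rw [waveOp_apply, htime, sub_add_cancel]
  rw [key]
  refine add_mem (Submodule.mem_map_of_mem hmem) (sum_mem fun m _ => ?_)
  rw [pderiv_pderiv_monomial]
  have hem : e (Sum.inl m) = s (Sum.inl m) := by simp [he]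
  rw [hem]
  rcases lt_or_ge (s (Sum.inl m)) 2 with h | h
  · interval_cases s (Sum.inl m) <;> simp
  have hle : Finsupp.single (Sum.inl m) 2 ≤ e := by
    rw [Finsupp.single_le_iff, hem]
    exact h
  refine ih _ ?_ (e - Finsupp.single (Sum.inl m) 2) ?_ _ rfl
  · rw [← hd]
    refine Finset.sum_lt_sum (fun j _ => ?_) ⟨m, Finset.mem_univ _, ?_⟩
    · simp [he]
    · simp only [he, Finsupp.tsub_apply, Finsupp.add_apply, Finsupp.single_eq_same]
      simp
      omega
  · have := congrArg Finsupp.degree (tsub_add_cancel_of_le hle)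
    simp only [he, map_add, Finsupp.degree_single] at this ⊢
    omega

theorem map_waveOp_restrictTotalDegree (n p : ℕ) {c : ℝ} (hc : c ≠ 0) :
    (restrictTotalDegree (Fin n ⊕ Unit) ℝ p).map (waveOp n c) =
      restrictSupport ℝ {s | s.degree + 2 ≤ p} := by
  rw [restrictTotalDegree_eq_restrictSupport_degree]
  apply le_antisymm
  · rintro _ ⟨f, hf, rfl⟩
    rw [waveOp_apply]
    exact sub_mem (Submodule.smul_mem _ _ (pderiv_pderiv_mem_restrictSupport _ hf))
      (sum_mem fun m _ => pderiv_pderiv_mem_restrictSupport _ hf)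
  · rw [restrictSupport_eq_span, Submodule.span_le]
    rintro _ ⟨s, hs, rfl⟩
    exact monomial_mem_map_waveOp hc s hs 1

theorem Submodule.finrank_map_add_finrank_inf_ker {K V W : Type*} [DivisionRing K]
    [AddCommGroup V] [Module K V] [AddCommGroup W] [Module K W] (f : V →ₗ[K] W)
    (S : Submodule K V) [FiniteDimensional K S] :
    Module.finrank K (S.map f) + Module.finrank K (S ⊓ LinearMap.ker f : Submodule K V) =
      Module.finrank K S := by
  rw [← LinearMap.finrank_range_add_finrank_ker (f.domRestrict S), LinearMap.range_domRestrict,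
    LinearMap.ker_domRestrict, ← Submodule.map_comap_subtype,
    (Submodule.equivSubtypeMap S _).finrank_eq]

/-- The dimension of the second-order polynomial Trefftz space:
`dim 𝕌^p = C(p+n, n) + C(p−1+n, n)`. -/
theorem trefftzU_finrank (n p : ℕ) (hn : 1 ≤ n) (hp : 1 ≤ p) (c : ℝ) (hc : 0 < c) :
    Module.finrank ℝ (trefftzU n p c) = (p + n).choose n + (p - 1 + n).choose n := by
  have h := Submodule.finrank_map_add_finrank_inf_ker (waveOp n c)
    (restrictTotalDegree (Fin n ⊕ Unit) ℝ p)
  rw [map_waveOp_restrictTotalDegree n p hc.ne', restrictTotalDegree_eq_restrictSupport_degree,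
    finrank_restrictSupport, finrank_restrictSupport, Finsupp.ncard_degree_le _ hp,
    Nat.add_left_cancel_iff] at h
  rw [trefftzU, restrictTotalDegree_eq_restrictSupport_degree, h]
  simp only [Fintype.card_sum, Fintype.card_fin, Fintype.card_unit, Nat.multichoose_eq]
  rw [← Nat.choose_symm_of_eq_add (n := p + n) (a := p) (b := n) rfl,
    ← Nat.choose_symm_of_eq_add (n := p - 1 + n) (a := p - 1) (b := n) rfl]
  congr 2 <;> omega
end

section
/- Let n ≥ 1, p ≥ 1, c > 0. Every space-time Trefftz polynomial U ∈ 𝕌^p is uniquely determined by its Cauchy data at t = 0: if U, V ∈ 𝕌^p satisfy U(·,0) = V(·,0) and ∂ₜU(·,0) = ∂ₜV(·,0) as polynomials in the space variables, then U = V. -/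
open MvPolynomial

/-- A space-time polynomial agrees modulo `t` with the extension, constant in time, of its
trace at `t = 0`. -/
theorem X_dvd_sub_rename_evalTimeZero (n : ℕ) (W : MvPolynomial (Fin n ⊕ Unit) ℝ) :
    X (Sum.inr ()) ∣ W - rename Sum.inl (evalTimeZero n W) := by
  induction W using MvPolynomial.induction_on with
  | C a => simp [evalTimeZero]
  | add f g hf hg =>
    rw [map_add, map_add, add_sub_add_comm]
    exact dvd_add hf hg
  | mul_X f i hf =>
    rcases i with m | ⟨⟩
    · have h : evalTimeZero n (X (Sum.inl m)) = X m := by simp [evalTimeZero]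
      rw [map_mul, map_mul, h, rename_X, ← sub_mul]
      exact hf.mul_right _
    · have h : evalTimeZero n (X (Sum.inr ())) = 0 := by simp [evalTimeZero]
      rw [map_mul, h, mul_zero, map_zero, sub_zero]
      exact dvd_mul_left _ _

/-- A polynomial vanishing at `t = 0` has no monomial free of `t`. -/
theorem coeff_eq_zero_of_evalTimeZero_eq_zero {n : ℕ} {W : MvPolynomial (Fin n ⊕ Unit) ℝ}
    (hW : evalTimeZero n W = 0) {d : Fin n ⊕ Unit →₀ ℕ} (hd : d (Sum.inr ()) = 0) :
    coeff d W = 0 := by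
  obtain ⟨q, hq⟩ : X (Sum.inr ()) ∣ W := by
    simpa [hW] using X_dvd_sub_rename_evalTimeZero n W
  rw [hq, coeff_X_mul', if_neg (by simp [hd])]

/-- The only polynomial solution of the wave equation with zero Cauchy data at `t = 0` is zero. -/
theorem eq_zero_of_waveOp_eq_zero {n : ℕ} {c : ℝ} (hc : c ≠ 0)
    {W : MvPolynomial (Fin n ⊕ Unit) ℝ} (hW : waveOp n c W = 0) (h₀ : evalTimeZero n W = 0)
    (h₁ : evalTimeZero n (pderiv (Sum.inr ()) W) = 0) : W = 0 := by
  suffices h : ∀ k (d : Fin n ⊕ Unit →₀ ℕ), d (Sum.inr ()) = 0 →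
      coeff (d + Finsupp.single (Sum.inr ()) k) W = 0 by
    ext d
    rw [coeff_zero, ← Finsupp.erase_add_single (Sum.inr ()) d]
    exact h _ _ Finsupp.erase_same
  intro k
  induction k using Nat.twoStepInduction with
  | zero =>
    intro d hd
    simpa using coeff_eq_zero_of_evalTimeZero_eq_zero h₀ hd
  | one =>
    intro d hd
    have h := coeff_eq_zero_of_evalTimeZero_eq_zero h₁ hd
    simpa [coeff_pderiv, hd] using h
  | more k ih _ =>
    intro d hd
    have h := congrArg (coeff (d + Finsupp.single (Sum.inr ()) k)) hW
    have hspace (m : Fin n) : coeff (d + Finsupp.single (Sum.inr ()) k +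
        Finsupp.single (Sum.inl m) 1 + Finsupp.single (Sum.inl m) 1) W = 0 := by
      rw [add_right_comm d, add_right_comm (d + _)]
      exact ih _ (by simp [hd])
    have htime : coeff (d + Finsupp.single (Sum.inr ()) k + Finsupp.single (Sum.inr ()) 1 +
        Finsupp.single (Sum.inr ()) 1) W * ((k : ℝ) + 1 + 1) * ((k : ℝ) + 1) = 0 := by
      simpa [waveOp, coeff_sum, coeff_pderiv, hspace, hd, hc] using h
    have hk₁ : (k : ℝ) + 1 ≠ 0 := by positivity
    have hk₂ : (k : ℝ) + 1 + 1 ≠ 0 := by positivity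
    rw [add_assoc, add_assoc, ← Finsupp.single_add, ← Finsupp.single_add] at htime
    exact (mul_eq_zero.mp ((mul_eq_zero.mp htime).resolve_right hk₁)).resolve_right hk₂

/-- Every space-time Trefftz polynomial `U ∈ 𝕌^p` is uniquely determined
by its Cauchy data at `t = 0`: if `U, V ∈ 𝕌^p` have `U(·,0) = V(·,0)` and
`∂ₜU(·,0) = ∂ₜV(·,0)` as polynomials in the space variables, then `U = V`. -/
theorem trefftzU_cauchyData_unique (n p : ℕ) (hn : 1 ≤ n) (hp : 1 ≤ p) (c : ℝ)
    (hc : 0 < c) :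
    ∀ U ∈ trefftzU n p c, ∀ V ∈ trefftzU n p c,
      evalTimeZero n U = evalTimeZero n V →
      evalTimeZero n (pderiv (Sum.inr ()) U) = evalTimeZero n (pderiv (Sum.inr ()) V) →
      U = V := by
  intro U hU V hV h₀ h₁
  refine sub_eq_zero.mp (eq_zero_of_waveOp_eq_zero hc.ne' ?_ ?_ ?_)
  · exact ((trefftzU n p c).sub_mem hU hV).2
  · rw [map_sub, h₀, sub_self]
  · rw [map_sub, map_sub, h₁, sub_self]
end
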